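/- Let F₂ be the free group on two generators. The left translation action of F₂ on the Hilbert space ℓ²(F₂; ℂ), given by (γ·G)(δ) = G(γ⁻¹δ), is NOT algebraically amenable. -/

import Mathlib

open scoped ENNReal

/-- A linear action `ρ` of a group `Γ` on a complex vector space `V` is *algebraically
amenable* if for every finite list `g₁, …, g_m` of elements of `Γ` and every `ε > 0`
there is a nonzero finite-dimensional subspace `W ⊆ V` with
`dim_ℂ (g₁W + ⋯ + g_mW) < (1 + ε) · dim_ℂ W`. -/
def AlgebraicallyAmenableAction {Γ V : Type*} [Group Γ] [AddCommGroup V] [Module ℂ V]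
    (ρ : Γ → (V →ₗ[ℂ] V)) : Prop :=
  ∀ (m : ℕ) (g : Fin m → Γ) (ε : ℝ), 0 < ε →
    ∃ W : Submodule ℂ V, W ≠ ⊥ ∧ FiniteDimensional ℂ W ∧
      (Module.finrank ℂ ↥(⨆ i, W.map (ρ (g i))) : ℝ) <
        (1 + ε) * (Module.finrank ℂ W : ℝ)

/-- The left translation operator `(γ · G)(δ) = G(γ⁻¹δ)` on `ℓ²(Γ; ℂ)`, as a
`ℂ`-linear map. -/
noncomputable def lpTranslate {Γ : Type*} [Group Γ] (γ : Γ) :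
    lp (fun _ : Γ => ℂ) 2 →ₗ[ℂ] lp (fun _ : Γ => ℂ) 2 where
  toFun f := ⟨fun δ => f (γ⁻¹ * δ), by
    have hf : Memℓp (⇑f) 2 := lp.memℓp f
    rw [memℓp_gen_iff (by norm_num)] at hf
    exact (memℓp_gen_iff (by norm_num)).2
      (((Equiv.mulLeft γ⁻¹).summable_iff
        (f := fun δ : Γ => ‖f δ‖ ^ (2 : ℝ≥0∞).toReal)).2 hf)⟩
  map_add' f g := by
    ext δ
    simp only [lp.coeFn_add, Pi.add_apply]
  map_smul' c f := by
    ext δ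
    simp only [lp.coeFn_smul, Pi.smul_apply, RingHom.id_apply]

namespace FreeGroup

variable {α : Type*} [DecidableEq α]

/-- In the Cayley graph of a free group, the endpoint of the edge `{g, g * s}` that is farther
from the identity. -/
def farEndpoint (g : FreeGroup α) (s : α) : FreeGroup α :=
  if g.toWord.getLast? = some (s, false) then g else g * of s

theorem toWord_mul_mk_singleton {g : FreeGroup α} {s : α} {b : Bool}
    (h : g.toWord.getLast? ≠ some (s, !b)) : (g * mk [(s, b)]).toWord = g.toWord ++ [(s, b)] := by
  rw [toWord_mul, toWord_mk, reduce_singleton]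
  apply IsReduced.reduce_eq
  refine List.isChain_append.2 ⟨isReduced_toWord, List.isChain_singleton _, ?_⟩
  rintro ⟨x, c⟩ hx y hy hxy
  obtain rfl : (s, b) = y := by simpa using hy
  obtain rfl : x = s := hxy
  by_contra hc
  apply h
  rw [Option.mem_def.1 hx]
  cases b <;> cases c <;> simp_all

theorem getLast?_toWord_inv_of_mul {g : FreeGroup α} {t : α} (h1 : g ≠ 1) (ht : g ≠ of t) :
    ((of t)⁻¹ * g).toWord.getLast? = g.toWord.getLast? := by
  have hw : ((of t)⁻¹ * g).toWord = reduce ((t, false) :: g.toWord) := by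
    rw [toWord_mul, toWord_inv, toWord_of]
    rfl
  rw [hw, reduce.cons, reduce_toWord]
  rcases hg : g.toWord with _ | ⟨⟨x, c⟩, tl⟩
  · exact absurd (toWord_eq_nil_iff.1 hg) h1
  · rcases tl with _ | ⟨y, tl⟩
    · have : ¬ (t = x ∧ c = true) := by
        rintro ⟨rfl, rfl⟩
        exact ht (toWord_injective (by rw [hg, toWord_of]))
      dsimp only
      rw [if_neg (by simpa using this)]
      simp
    · dsimp only
      split_ifs <;> simp

theorem farEndpoint_inv_of_mul {g : FreeGroup α} {s t : α} (h : g ≠ 1 ∨ s ≠ t) :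
    farEndpoint ((of t)⁻¹ * g) s = (of t)⁻¹ * farEndpoint g s := by
  have key : ((of t)⁻¹ * g).toWord.getLast? = some (s, false) ↔
      g.toWord.getLast? = some (s, false) := by
    by_cases h1 : g = 1
    · subst h1
      have : t ≠ s := fun e => by simp_all
      simp [toWord_inv, invRev, this]
    · by_cases ht : g = of t
      · subst ht
        simp
      · rw [getLast?_toWord_inv_of_mul h1 ht]
  unfold farEndpoint
  simp only [key]
  split_ifs <;> simp [mul_assoc]

theorem farEndpoint_one (s : α) : farEndpoint 1 s = of s := by
  simp [farEndpoint]

theorem farEndpoint_inv_of (s : α) : farEndpoint (of s)⁻¹ s = (of s)⁻¹ := by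
  simp [farEndpoint, toWord_inv, invRev]

theorem getLast?_toWord_farEndpoint (g : FreeGroup α) (s : α) :
    (farEndpoint g s).toWord.getLast? =
      some (s, !decide (g.toWord.getLast? = some (s, false))) := by
  unfold farEndpoint
  split_ifs with h
  · simp [h]
  · rw [show of s = mk [(s, true)] from rfl, toWord_mul_mk_singleton (by simpa using h)]
    simp [h]

theorem farEndpoint_ne_one (g : FreeGroup α) (s : α) : farEndpoint g s ≠ 1 := by
  intro h
  have := getLast?_toWord_farEndpoint g s
  simp [h] at this

theorem farEndpoint_inj {g h : FreeGroup α} {s t : α} (e : farEndpoint g s = farEndpoint h t) :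
    g = h ∧ s = t := by
  have hg := getLast?_toWord_farEndpoint g s
  have hh := getLast?_toWord_farEndpoint h t
  rw [e, hh, Option.some_inj, Prod.mk.injEq] at hg
  obtain ⟨rfl, hd⟩ := hg
  refine ⟨?_, rfl⟩
  have hd' : (h.toWord.getLast? = some (t, false)) ↔ (g.toWord.getLast? = some (t, false)) := by
    simpa using hd
  unfold farEndpoint at e
  simp only [hd'] at e
  split_ifs at e
  · exact e
  · exact mul_right_cancel e

theorem exists_farEndpoint_eq {g : FreeGroup α} (hg : g ≠ 1) : ∃ h s, farEndpoint h s = g := by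
  have hne : g.toWord ≠ [] := fun h => hg (toWord_eq_nil_iff.1 h)
  obtain ⟨L, ⟨s, b⟩, hL⟩ := List.eq_nil_or_concat' g.toWord |>.resolve_left hne
  cases b
  · exact ⟨g, s, by simp [farEndpoint, hL]⟩
  · have hred : IsReduced (L ++ [(s, true)]) := hL ▸ isReduced_toWord
    have hchain := List.isChain_append.1 hred
    have hgm : g = mk L * of s := by
      rw [← mk_toWord (x := g), hL]
      rfl
    have hw : (mk L).toWord = L := by
      rw [toWord_mk]
      exact IsReduced.reduce_eq hchain.1
    refine ⟨mk L, s, ?_⟩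
    rw [farEndpoint, if_neg, hgm]
    rw [hw]
    intro hl
    simpa using hchain.2.2 _ hl (s, true) (by simp) rfl

end FreeGroup

section HilbertSpace

variable {E : Type*} [NormedAddCommGroup E] [InnerProductSpace ℂ E]

/-- If `B ⊔ K` is dominated by `H` at the vector `x`, then `B` is dominated at `x` by the
orthogonal complement `A` of `K` in `H`. -/
theorem norm_starProjection_le_of_forall_norm_inner_le {A B H K : Submodule ℂ E}
    [A.HasOrthogonalProjection] [B.HasOrthogonalProjection] [H.HasOrthogonalProjection]
    [K.HasOrthogonalProjection] (hKH : K ≤ H) (hA : A = H ⊓ Kᗮ) (hB : B ≤ Kᗮ) (x : E)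
    (h : ∀ v ∈ B ⊔ K, ‖inner ℂ x v‖ ≤ ‖H.starProjection x‖ * ‖v‖) :
    ‖B.starProjection x‖ ≤ ‖A.starProjection x‖ := by
  have hHx : H.starProjection x = K.starProjection x + A.starProjection x := by
    have hmem : H.starProjection x - K.starProjection x ∈ A := by
      rw [hA]
      refine ⟨H.sub_mem (Submodule.starProjection_apply_mem H x)
        (hKH (Submodule.starProjection_apply_mem K x)), ?_⟩
      have h1 := K.sub_starProjection_mem_orthogonal x
      have h2 := Submodule.orthogonal_le hKH (H.sub_starProjection_mem_orthogonal x)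
      simpa using Kᗮ.sub_mem h1 h2
    have := Submodule.eq_starProjection_of_mem_orthogonal (u := x) hmem (by
      have h1 : x - H.starProjection x ∈ Aᗮ :=
        Submodule.orthogonal_le (by rw [hA]; exact inf_le_left)
          (H.sub_starProjection_mem_orthogonal x)
      have h2 : K.starProjection x ∈ Aᗮ :=
        Submodule.orthogonal_le (by rw [hA]; exact inf_le_right)
          (K.le_orthogonal_orthogonal (Submodule.starProjection_apply_mem K x))
      rw [sub_sub_eq_add_sub, add_sub_right_comm]
      exact Aᗮ.add_mem h1 h2)
    rw [this]
    abel
  have horthA : inner ℂ (K.starProjection x) (A.starProjection x) = 0 := by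
    have : A.starProjection x ∈ H ⊓ Kᗮ := hA ▸ Submodule.starProjection_apply_mem A x
    exact this.2 _ (Submodule.starProjection_apply_mem K x)
  have horthB : inner ℂ (K.starProjection x) (B.starProjection x) = 0 :=
    hB (Submodule.starProjection_apply_mem B x) _ (Submodule.starProjection_apply_mem K x)
  have hnH := norm_add_sq_eq_norm_sq_add_norm_sq_of_inner_eq_zero _ _ horthA
  have hnV := norm_add_sq_eq_norm_sq_add_norm_sq_of_inner_eq_zero _ _ horthB
  rw [← hHx] at hnH
  set v := K.starProjection x + B.starProjection x with hv
  have hvx : inner ℂ x v = ((‖v‖ ^ 2 : ℝ) : ℂ) := by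
    have h1 : inner ℂ (x - v) v = 0 := by
      have h2 : x - v = (x - K.starProjection x) - B.starProjection x := by rw [hv]; abel
      have h3 : x - v = (x - B.starProjection x) - K.starProjection x := by rw [hv]; abel
      have h4 : inner ℂ (x - v) (K.starProjection x) = 0 := by
        rw [h2, inner_sub_left, K.starProjection_inner_eq_zero _ _
          (Submodule.starProjection_apply_mem K x), ← inner_conj_symm, horthB]
        simp
      have h5 : inner ℂ (x - v) (B.starProjection x) = 0 := by
        rw [h3, inner_sub_left, B.starProjection_inner_eq_zero _ _
          (Submodule.starProjection_apply_mem B x), horthB]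
        simp
      conv_lhs => rw [hv, inner_add_right, ← hv]
      rw [h4, h5, add_zero]
    rw [inner_sub_left, sub_eq_zero] at h1
    rw [h1, inner_self_eq_norm_sq_to_K]
    simp
  have hle := h v (hv ▸ add_comm (B.starProjection x) _ ▸
    Submodule.add_mem_sup (Submodule.starProjection_apply_mem B x)
      (Submodule.starProjection_apply_mem K x))
  rw [hvx, Complex.norm_real, Real.norm_of_nonneg (sq_nonneg _)] at hle
  have hvH : ‖v‖ ≤ ‖H.starProjection x‖ := by
    by_contra hlt
    push Not at hlt
    nlinarith [norm_nonneg v, norm_nonneg (H.starProjection x)]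
  have hfin : ‖v‖ * ‖v‖ ≤ ‖H.starProjection x‖ * ‖H.starProjection x‖ :=
    mul_self_le_mul_self (norm_nonneg _) hvH
  refine abs_le_of_sq_le_sq' (a := ‖B.starProjection x‖) ?_ (norm_nonneg _) |>.2
  nlinarith

theorem norm_sq_starProjection_eq_sum {A : Submodule ℂ E} [FiniteDimensional ℂ A] {ι : Type*}
    [Fintype ι] (b : OrthonormalBasis ι ℂ A) (x : E) :
    ‖A.starProjection x‖ ^ 2 = ∑ j, ‖inner ℂ (b j : E) x‖ ^ 2 := by
  rw [Submodule.starProjection_apply, Submodule.norm_coe, ← b.sum_sq_norm_inner_right]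
  simp only [Submodule.inner_orthogonalProjectionOnto_eq_of_mem_left]

/-- The squared norms of the projections of the standard basis of `ℓ²` to a finite-dimensional
subspace add up to its dimension. -/
theorem hasSum_norm_sq_starProjection_single {X : Type*} [DecidableEq X]
    (A : Submodule ℂ (lp (fun _ : X => ℂ) 2)) [FiniteDimensional ℂ A] :
    HasSum (fun x => ‖A.starProjection (lp.single 2 x (1 : ℂ))‖ ^ 2)
      (Module.finrank ℂ A : ℝ) := by
  let b := stdOrthonormalBasis ℂ A
  have h1 : ∀ x, ‖A.starProjection (lp.single 2 x (1 : ℂ))‖ ^ 2 =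
      ∑ j, ‖((b j : A) : lp (fun _ : X => ℂ) 2) x‖ ^ 2 := by
    intro x
    rw [norm_sq_starProjection_eq_sum b]
    refine Finset.sum_congr rfl fun j _ => ?_
    rw [lp.inner_single_right]
    simp
  simp only [h1]
  have h2 : ((Module.finrank ℂ A : ℕ) : ℝ) = ∑ j : Fin (Module.finrank ℂ A), (1 : ℝ) := by simp
  rw [h2]
  refine hasSum_sum fun j _ => ?_
  have h3 := lp.hasSum_norm (p := 2) (by norm_num) ((b j : A) : lp (fun _ : X => ℂ) 2)
  have h4 : ‖((b j : A) : lp (fun _ : X => ℂ) 2)‖ = 1 := by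
    rw [Submodule.norm_coe]
    exact b.orthonormal.1 j
  rw [h4] at h3
  simpa using h3

end HilbertSpace

section lpReindex

variable {X Y : Type*}

theorem lp.exists_comp_injective {m : X → Y} (hm : Function.Injective m)
    (v : lp (fun _ : Y => ℂ) 2) :
    ∃ u : lp (fun _ : X => ℂ) 2, (∀ x, u x = v (m x)) ∧ ‖u‖ ≤ ‖v‖ := by
  have hv := (lp.hasSum_norm (p := 2) (by norm_num) v).summable
  have hu : Memℓp (fun x => v (m x)) 2 :=
    (memℓp_gen_iff (by norm_num)).2 (hv.comp_injective hm)
  refine ⟨⟨fun x => v (m x), hu⟩, fun x => rfl, ?_⟩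
  refine lp.norm_le_of_tsum_le (by norm_num) (norm_nonneg _) ?_
  rw [lp.norm_rpow_eq_tsum (by norm_num)]
  exact tsum_comp_le_tsum_of_inj hv (fun y => by positivity) hm

theorem lp.exists_extend_injective {m : X → Y} (hm : Function.Injective m)
    (v : lp (fun _ : X => ℂ) 2) :
    ∃ u : lp (fun _ : Y => ℂ) 2, (∀ x, u (m x) = v x) ∧ ∀ y, (∀ x, m x ≠ y) → u y = 0 := by
  have hv := (lp.hasSum_norm (p := 2) (by norm_num) v).summable
  have hu : Memℓp (Function.extend m v 0 : Y → ℂ) 2 := by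
    refine (memℓp_gen_iff (by norm_num)).2 ((hm.summable_iff ?_).1 ?_)
    · intro y hy
      rw [Function.extend_apply' _ _ _ hy]
      simp
    · convert hv using 2 with x
      simp [hm.extend_apply]
  refine ⟨⟨_, hu⟩, fun x => hm.extend_apply _ _ x, fun y hy => ?_⟩
  exact Function.extend_apply' (f := m) v (0 : Y → ℂ) y fun ⟨x, hx⟩ => hy x hx

theorem exists_lp_prod_apply_eq {ι : Type*} [Fintype ι] (v : ι → lp (fun _ : X => ℂ) 2) :
    ∃ u : lp (fun _ : X × ι => ℂ) 2, ∀ x i, u (x, i) = v i x := by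
  have hinj : ∀ i : ι, Function.Injective fun x : X => (x, i) :=
    fun i x y e => (Prod.mk.inj e).1
  choose u hu hu0 using fun i => lp.exists_extend_injective (hinj i) (v i)
  refine ⟨∑ i, u i, fun x i => ?_⟩
  rw [lp.coeFn_sum, Finset.sum_apply, Finset.sum_eq_single i]
  · exact hu i x
  · exact fun j _ hji => hu0 j _ fun y hy => hji (Prod.mk.inj hy).2
  · simp

end lpReindex

section PartialRepresentation

variable {α W ι : Type*} [AddCommGroup W] [Module ℂ W]

/-- An element of `ℓ²(G × ι)` viewed as a function on `G` with values in the dual of a space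
with basis `b` indexed by `ι`, evaluated at `g`. -/
noncomputable def evalDual {G : Type*} (b : Module.Basis ι ℂ W) (g : G) :
    lp (fun _ : G × ι => ℂ) 2 →ₗ[ℂ] Module.Dual ℂ W :=
  (b.constr ℂ).toLinearMap ∘ₗ
    LinearMap.pi fun i => (lp.evalCLM ℂ (fun _ : G × ι => ℂ) 2 (g, i)).toLinearMap

theorem evalDual_apply {G : Type*} [Fintype ι] (b : Module.Basis ι ℂ W) (g : G)
    (φ : lp (fun _ : G × ι => ℂ) 2) (w : W) :
    evalDual b g φ w = ∑ i, b.repr w i * φ (g, i) := by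
  simp [evalDual, Module.Basis.constr_apply_fintype, lp.evalCLM]

theorem evalDual_basis {G : Type*} (b : Module.Basis ι ℂ W) (g : G)
    (φ : lp (fun _ : G × ι => ℂ) 2) (i : ι) : evalDual b g φ (b i) = φ (g, i) := by
  simp [evalDual, lp.evalCLM]

theorem evalDual_congr {G G' : Type*} (b : Module.Basis ι ℂ W) {g : G} {g' : G'}
    {φ : lp (fun _ : G × ι => ℂ) 2} {ψ : lp (fun _ : G' × ι => ℂ) 2}
    (h : ∀ i, φ (g, i) = ψ (g', i)) : evalDual b g φ = evalDual b g' ψ := by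
  refine b.ext fun i => ?_
  rw [evalDual_basis, evalDual_basis, h]

theorem continuous_evalDual {G : Type*} [Fintype ι] (b : Module.Basis ι ℂ W) (g : G) (w : W) :
    Continuous fun φ => evalDual b g φ w := by
  simp only [evalDual_apply]
  exact continuous_finsetSum _ fun i _ =>
    continuous_const.mul (lp.evalCLM ℂ (fun _ : G × ι => ℂ) 2 (g, i)).continuous

/-- Given partial maps `τ t : D t → W`, the functions `φ : FreeGroup α → Dual W` in `ℓ²` whose
composition with `j` intertwines `τ t` with the left translation by `t`. -/
noncomputable def intertwiningSubmodule (b : Module.Basis ι ℂ W) (D : α → Submodule ℂ W)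
    (τ : ∀ t, D t →ₗ[ℂ] W) (j : FreeGroup α → FreeGroup α) :
    Submodule ℂ (lp (fun _ : FreeGroup α × ι => ℂ) 2) where
  carrier := {φ | ∀ t (w : D t) g,
    evalDual b (j g) φ (τ t w) = evalDual b (j ((FreeGroup.of t)⁻¹ * g)) φ w}
  add_mem' hφ hψ t w g := by simp [hφ t w g, hψ t w g]
  zero_mem' t w g := by simp
  smul_mem' c φ hφ t w g := by simp [hφ t w g]

variable (b : Module.Basis ι ℂ W) (D : α → Submodule ℂ W) (τ : ∀ t, D t →ₗ[ℂ] W)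

theorem isClosed_intertwiningSubmodule [Fintype ι] (j : FreeGroup α → FreeGroup α) :
    IsClosed (intertwiningSubmodule b D τ j : Set (lp (fun _ : FreeGroup α × ι => ℂ) 2)) := by
  have : (intertwiningSubmodule b D τ j : Set (lp (fun _ : FreeGroup α × ι => ℂ) 2)) =
      ⋂ t, ⋂ w : D t, ⋂ g, {φ | evalDual b (j g) φ (τ t w) =
        evalDual b (j ((FreeGroup.of t)⁻¹ * g)) φ w} := by
    ext φ
    simp [intertwiningSubmodule]
  rw [this]
  exact isClosed_iInter fun t => isClosed_iInter fun w => isClosed_iInter fun g =>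
    isClosed_eq (continuous_evalDual b _ _) (continuous_evalDual b _ _)

/-- The elements of the intertwining submodule that vanish at the identity. -/
noncomputable def intertwiningVanishing : Submodule ℂ (lp (fun _ : FreeGroup α × ι => ℂ) 2) :=
  intertwiningSubmodule b D τ id ⊓ LinearMap.ker (evalDual b 1)

theorem isClosed_intertwiningVanishing [Fintype ι] :
    IsClosed (intertwiningVanishing b D τ : Set (lp (fun _ : FreeGroup α × ι => ℂ) 2)) := by
  refine (isClosed_intertwiningSubmodule b D τ id).inter ?_
  have : (LinearMap.ker (evalDual b (1 : FreeGroup α)) :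
      Set (lp (fun _ : FreeGroup α × ι => ℂ) 2)) = ⋂ w, {φ | evalDual b 1 φ w = 0} := by
    ext φ
    simp [LinearMap.ext_iff]
  rw [this]
  exact isClosed_iInter fun w => isClosed_eq (continuous_evalDual b _ _) continuous_const

/-- Evaluation of `φ` at the inverses of the generators, on the domains of the partial maps. -/
noncomputable def evalInvGenerators :
    lp (fun _ : FreeGroup α × ι => ℂ) 2 →ₗ[ℂ] ∀ t, Module.Dual ℂ (D t) :=
  LinearMap.pi fun t => (D t).subtype.dualMap ∘ₗ evalDual b (FreeGroup.of t)⁻¹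

theorem evalInvGenerators_eq_zero {φ : lp (fun _ : FreeGroup α × ι => ℂ) 2}
    (hφ : φ ∈ intertwiningVanishing b D τ) : evalInvGenerators b D φ = 0 := by
  ext t w
  have := hφ.1 t w 1
  simp only [id, mul_one, LinearMap.mem_ker.1 hφ.2, LinearMap.zero_apply] at this
  simp [evalInvGenerators, ← this]

variable {D τ} in
theorem exists_mem_intertwiningSubmodule_evalDual_eq [Fintype ι] [FiniteDimensional ℂ W]
    {J : W →ₗ[ℂ] lp (fun _ : FreeGroup α => ℂ) 2} (hJ : Function.Injective J)
    (hτ : ∀ t w g, J (τ t w) g = J w ((FreeGroup.of t)⁻¹ * g))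
    (g : FreeGroup α) (l : Module.Dual ℂ W) :
    ∃ φ ∈ intertwiningSubmodule b D τ id, evalDual b g φ = l := by
  have hbot : ((intertwiningSubmodule b D τ id).map (evalDual b g)).dualCoannihilator = ⊥ := by
    rw [Submodule.eq_bot_iff]
    intro w hw
    rw [Submodule.mem_dualCoannihilator] at hw
    refine hJ ?_
    rw [map_zero]
    ext k
    obtain ⟨u, hu⟩ := exists_lp_prod_apply_eq fun i => J (b i)
    obtain ⟨φ, hφ, -⟩ := lp.exists_comp_injective
      (m := fun y : FreeGroup α × ι => (y.1 * (g⁻¹ * k), y.2))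
      (fun y z e => by
        simp only [Prod.mk.injEq, mul_left_inj] at e
        exact Prod.ext e.1 e.2) u
    have hev : ∀ h v, evalDual b h φ v = J v (h * (g⁻¹ * k)) := by
      intro h v
      have hJv : J v = ∑ i, b.repr v i • J (b i) := by
        simp only [← map_smul, ← map_sum, b.sum_repr]
      rw [evalDual_apply, hJv, lp.coeFn_sum]
      simp [hφ, hu]
    have := hw _ (Submodule.mem_map_of_mem (f := evalDual b g) (show φ ∈ _ from fun t w h => by
      simp only [id]
      rw [hev, hev, hτ, mul_assoc]))
    rw [hev, mul_inv_cancel_left] at this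
    simpa using this
  have htop : (intertwiningSubmodule b D τ id).map (evalDual b g) = ⊤ := by
    rw [← Subspace.dualCoannihilator_dualAnnihilator_eq
      (W := (intertwiningSubmodule b D τ id).map (evalDual b g)), hbot,
      Submodule.dualAnnihilator_bot]
  have : l ∈ (intertwiningSubmodule b D τ id).map (evalDual b g) := htop ▸ Submodule.mem_top
  exact this

variable [DecidableEq α]

/-- The functions vanishing at the identity which, for each generator `s`, intertwine as functions
on the edges labelled by `s`, an edge taking the value at its far endpoint. -/
noncomputable def edgeIntertwining : Submodule ℂ (lp (fun _ : FreeGroup α × ι => ℂ) 2) :=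
  LinearMap.ker (evalDual b 1) ⊓
    ⨅ s, intertwiningSubmodule b D τ fun g => FreeGroup.farEndpoint g s

theorem intertwiningVanishing_le_edgeIntertwining :
    intertwiningVanishing b D τ ≤ edgeIntertwining b D τ := by
  rintro φ ⟨hφ, h1⟩
  replace h1 : evalDual b 1 φ = 0 := h1
  refine ⟨h1, (Submodule.mem_iInf _).2 fun s t w g => ?_⟩
  beta_reduce
  by_cases h : g ≠ 1 ∨ s ≠ t
  · rw [FreeGroup.farEndpoint_inv_of_mul h]
    exact hφ t w _
  · push Not at h
    obtain ⟨rfl, rfl⟩ := h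
    have e1 := hφ s w (FreeGroup.of s)
    have e2 := hφ s w 1
    simp only [id, inv_mul_cancel, mul_one, h1, LinearMap.zero_apply] at e1 e2
    rw [FreeGroup.farEndpoint_one, mul_one, FreeGroup.farEndpoint_inv_of, e1, ← e2]

variable {b D τ} in
theorem norm_apply_le_of_mem_edgeIntertwining [DecidableEq ι]
    [(intertwiningSubmodule b D τ id).HasOrthogonalProjection]
    {v : lp (fun _ : FreeGroup α × ι => ℂ) 2} (hv : v ∈ edgeIntertwining b D τ)
    (x : FreeGroup α × ι) :
    ‖v x‖ ≤ ‖(intertwiningSubmodule b D τ id).starProjection (lp.single 2 x (1 : ℂ))‖ * ‖v‖ := by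
  obtain ⟨g, i⟩ := x
  by_cases hg : g = 1
  · have : v (g, i) = 0 := by
      rw [hg, ← evalDual_basis b, LinearMap.mem_ker.1 hv.1, LinearMap.zero_apply]
    rw [this, norm_zero]
    positivity
  obtain ⟨h, s, hs⟩ := FreeGroup.exists_farEndpoint_eq hg
  have hinj : Function.Injective fun y : FreeGroup α × ι =>
      (FreeGroup.farEndpoint (y.1 * (g⁻¹ * h)) s, y.2) := by
    rintro ⟨k, i⟩ ⟨k', i'⟩ e
    simp only [Prod.mk.injEq] at e
    rw [mul_right_cancel (FreeGroup.farEndpoint_inj e.1).1, e.2]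
  obtain ⟨u, hu, hle⟩ := lp.exists_comp_injective hinj v
  have hev : ∀ k, evalDual b k u =
      evalDual b (FreeGroup.farEndpoint (k * (g⁻¹ * h)) s) v :=
    fun k => evalDual_congr b fun i => hu (k, i)
  have huH : u ∈ intertwiningSubmodule b D τ id := by
    intro t w k
    rw [hev, hev]
    simpa [mul_assoc] using (Submodule.mem_iInf _).1 hv.2 s t w (k * (g⁻¹ * h))
  have hux : v (g, i) = u (g, i) := by simp [hu, hs]
  have hin : u (g, i) = inner ℂ ((intertwiningSubmodule b D τ id).starProjection
      (lp.single 2 (g, i) (1 : ℂ))) u := by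
    rw [Submodule.inner_starProjection_left_eq_right,
      Submodule.starProjection_eq_self_iff.2 huH, lp.inner_single_left]
    simp
  rw [hux, hin]
  exact (norm_inner_le_norm _ _).trans (by gcongr)

variable {D τ} in
theorem exists_mem_edgeIntertwining_evalInvGenerators_eq [Fintype α] [Fintype ι]
    [FiniteDimensional ℂ W]
    {J : W →ₗ[ℂ] lp (fun _ : FreeGroup α => ℂ) 2} (hJ : Function.Injective J)
    (hτ : ∀ t w g, J (τ t w) g = J w ((FreeGroup.of t)⁻¹ * g))
    (l : ∀ t, Module.Dual ℂ (D t)) :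
    ∃ φ ∈ edgeIntertwining b D τ, evalInvGenerators b D φ = l := by
  choose l' hl' using fun t => LinearMap.exists_extend (l t)
  choose ψ hψ hψl using fun t =>
    exists_mem_intertwiningSubmodule_evalDual_eq b hJ hτ (FreeGroup.of t)⁻¹ (l' t)
  have hinj : ∀ s, Function.Injective fun y : FreeGroup α × ι =>
      (FreeGroup.farEndpoint y.1 s, y.2) := by
    rintro s ⟨k, i⟩ ⟨k', i'⟩ e
    simp only [Prod.mk.injEq] at e
    rw [(FreeGroup.farEndpoint_inj e.1).1, e.2]
  choose u hu hu0 using fun s => lp.exists_extend_injective (hinj s) (ψ s)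
  have hfar : ∀ g s i, (∑ t, u t) (FreeGroup.farEndpoint g s, i) = ψ s (g, i) := by
    intro g s i
    rw [lp.coeFn_sum, Finset.sum_apply, Finset.sum_eq_single s]
    · exact hu s (g, i)
    · intro t _ hts
      refine hu0 t _ fun y hy => hts ?_
      exact (FreeGroup.farEndpoint_inj (Prod.mk.inj hy).1).2
    · simp
  have hev : ∀ g s, evalDual b (FreeGroup.farEndpoint g s) (∑ t, u t) = evalDual b g (ψ s) :=
    fun g s => evalDual_congr b (hfar g s)
  refine ⟨∑ t, u t, ⟨?_, (Submodule.mem_iInf _).2 fun s t w g => ?_⟩, ?_⟩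
  · refine LinearMap.mem_ker.2 (b.ext fun i => ?_)
    rw [evalDual_basis, lp.coeFn_sum, Finset.sum_apply]
    refine Finset.sum_eq_zero fun t _ => hu0 t _ fun y hy => ?_
    exact FreeGroup.farEndpoint_ne_one _ _ (Prod.mk.inj hy).1
  · rw [hev, hev]
    exact hψ s t w g
  · ext t w
    have := hev (FreeGroup.of t)⁻¹ t
    rw [FreeGroup.farEndpoint_inv_of, hψl] at this
    simp only [evalInvGenerators, LinearMap.pi_apply, LinearMap.comp_apply, this]
    rw [← hl' t]
    rfl

variable {D τ} in
/-- If the partial maps `τ t : D t → W` are restrictions of the left translations of `ℓ²` by the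
free generators, then the dimensions of their domains add up to less than `dim W`. -/
theorem sum_finrank_lt_finrank [Fintype α] [FiniteDimensional ℂ W] [Nontrivial W]
    {J : W →ₗ[ℂ] lp (fun _ : FreeGroup α => ℂ) 2} (hJ : Function.Injective J)
    (hτ : ∀ t w g, J (τ t w) g = J w ((FreeGroup.of t)⁻¹ * g)) :
    ∑ t, Module.finrank ℂ (D t) < Module.finrank ℂ W := by
  classical
  let b := Module.finBasis ℂ W
  let H := intertwiningSubmodule b D τ id
  let K := intertwiningVanishing b D τ
  let Q := edgeIntertwining b D τ
  have : CompleteSpace H := (isClosed_intertwiningSubmodule b D τ id).completeSpace_coe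
  have : CompleteSpace K := (isClosed_intertwiningVanishing b D τ).completeSpace_coe
  have hKH : K ≤ H := inf_le_left
  have hKQ : K ≤ Q := intertwiningVanishing_le_edgeIntertwining b D τ
  let A := H ⊓ Kᗮ
  have hevA : Function.Injective ((evalDual b (1 : FreeGroup α)).domRestrict A) := by
    rw [injective_iff_map_eq_zero]
    rintro ⟨φ, hφH, hφK⟩ h0
    have hmem : φ ∈ K := ⟨hφH, h0⟩
    exact Subtype.ext (inner_self_eq_zero.1 (hφK φ hmem))
  have : FiniteDimensional ℂ A := FiniteDimensional.of_injective _ hevA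
  have hA : Module.finrank ℂ A ≤ Module.finrank ℂ W :=
    (LinearMap.finrank_le_finrank_of_injective hevA).trans_eq Subspace.dual_finrank_eq
  have hsurj : Function.Surjective ((evalInvGenerators b D).domRestrict (Q ⊓ Kᗮ)) := by
    intro l
    obtain ⟨φ, hφ, hl⟩ := exists_mem_edgeIntertwining_evalInvGenerators_eq b hJ hτ l
    have hmem : φ - K.starProjection φ ∈ Q ⊓ Kᗮ :=
      ⟨Q.sub_mem hφ (hKQ (Submodule.starProjection_apply_mem K φ)),
        K.sub_starProjection_mem_orthogonal φ⟩
    refine ⟨⟨_, hmem⟩, ?_⟩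
    rw [LinearMap.domRestrict_apply, map_sub, hl,
      evalInvGenerators_eq_zero b D τ (Submodule.starProjection_apply_mem K φ), sub_zero]
  obtain ⟨σ, hσ⟩ := LinearMap.exists_rightInverse_of_surjective _ (LinearMap.range_eq_top.2 hsurj)
  let B := LinearMap.range ((Q ⊓ Kᗮ).subtype ∘ₗ σ)
  have hB : Module.finrank ℂ B = ∑ t, Module.finrank ℂ (D t) := by
    have hinj : Function.Injective ((Q ⊓ Kᗮ).subtype ∘ₗ σ) :=
      (Submodule.injective_subtype _).comp
        (Function.LeftInverse.injective
          (g := (evalInvGenerators b D).domRestrict (Q ⊓ Kᗮ)) (LinearMap.congr_fun hσ))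
    rw [LinearMap.finrank_range_of_inj hinj, Module.finrank_pi_fintype]
    exact Finset.sum_congr rfl fun t _ => Subspace.dual_finrank_eq
  have hBle : B ≤ Q ⊓ Kᗮ := by
    rintro _ ⟨l, rfl⟩
    exact (σ l).2
  have hle : ∀ x, ‖B.starProjection (lp.single 2 x (1 : ℂ))‖ ^ 2 ≤
      ‖A.starProjection (lp.single 2 x (1 : ℂ))‖ ^ 2 := by
    intro x
    refine pow_le_pow_left₀ (norm_nonneg _) ?_ 2
    refine norm_starProjection_le_of_forall_norm_inner_le hKH rfl (hBle.trans inf_le_right) _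
      fun v hv => ?_
    have hvQ : v ∈ Q := sup_le (hBle.trans inf_le_left) hKQ hv
    rw [lp.inner_single_left]
    simpa using norm_apply_le_of_mem_edgeIntertwining hvQ x
  obtain ⟨i⟩ : Nonempty (Fin (Module.finrank ℂ W)) := ⟨⟨0, Module.finrank_pos⟩⟩
  have hBone : B.starProjection (lp.single 2 ((1 : FreeGroup α), i) (1 : ℂ)) = 0 := by
    rw [Submodule.starProjection_apply_eq_zero_iff, Submodule.mem_orthogonal]
    intro v hv
    have : evalDual b 1 v = 0 := (hBle hv).1.1
    rw [lp.inner_single_right, ← evalDual_basis b, this]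
    simp
  have hAone : A.starProjection (lp.single 2 ((1 : FreeGroup α), i) (1 : ℂ)) ≠ 0 := by
    rw [Ne, Submodule.starProjection_apply_eq_zero_iff]
    intro hA0
    obtain ⟨φ, hφ, hφi⟩ := exists_mem_intertwiningSubmodule_evalDual_eq b hJ hτ 1 (b.coord i)
    have hPK : evalDual b 1 (K.starProjection φ) = 0 :=
      (Submodule.starProjection_apply_mem K φ).2
    have hmem : φ - K.starProjection φ ∈ A :=
      ⟨H.sub_mem hφ (hKH (Submodule.starProjection_apply_mem K φ)),
        K.sub_starProjection_mem_orthogonal φ⟩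
    have := hA0 _ hmem
    rw [lp.inner_single_right, ← evalDual_basis b, map_sub, hPK, hφi] at this
    simp at this
  have hlt := hasSum_lt hle (i := ((1 : FreeGroup α), i))
    (by
      rw [hBone, norm_zero, zero_pow two_ne_zero]
      exact pow_pos (norm_pos_iff.2 hAone) 2)
    (hasSum_norm_sq_starProjection_single B) (hasSum_norm_sq_starProjection_single A)
  rw [← hB]
  exact (Nat.cast_lt.1 hlt).trans_le hA

end PartialRepresentation

theorem lpTranslate_injective {Γ : Type*} [Group Γ] (γ : Γ) :
    Function.Injective (lpTranslate γ) := by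
  intro f g h
  ext δ
  simpa [lpTranslate] using congrArg (fun u : lp (fun _ : Γ => ℂ) 2 => u (γ * δ)) h

/-- For a nonzero finite-dimensional subspace `W` of `ℓ²` of a free group of finite rank, the
dimensions of the intersections of `W` with its translates by the generators add up to less than
the dimension of `W`. -/
theorem sum_finrank_inf_map_lpTranslate_lt {α : Type*} [Fintype α]
    (W : Submodule ℂ (lp (fun _ : FreeGroup α => ℂ) 2)) [FiniteDimensional ℂ W] (hW : W ≠ ⊥) :
    ∑ t, Module.finrank ℂ ↥(W ⊓ W.map (lpTranslate (FreeGroup.of t))) <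
      Module.finrank ℂ W := by
  classical
  have : Nontrivial W := Submodule.nontrivial_iff_ne_bot.2 hW
  let T (t : α) : W →ₗ[ℂ] lp (fun _ : FreeGroup α => ℂ) 2 :=
    lpTranslate (FreeGroup.of t) ∘ₗ W.subtype
  let D (t : α) : Submodule ℂ W := W.comap (T t)
  let τ (t : α) : D t →ₗ[ℂ] W := ((T t).domRestrict (D t)).codRestrict W fun w => w.2
  have hlt := sum_finrank_lt_finrank (D := D) (τ := τ) (J := W.subtype)
    W.injective_subtype fun t w g => rfl
  refine lt_of_eq_of_lt (Finset.sum_congr rfl fun t _ => ?_) hlt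
  have hinj : Function.Injective (T t) :=
    (lpTranslate_injective _).comp W.injective_subtype
  have hmap : W ⊓ W.map (lpTranslate (FreeGroup.of t)) = (D t).map (T t) := by
    ext f
    constructor
    · rintro ⟨hf, w, hw, rfl⟩
      exact ⟨⟨w, hw⟩, hf, rfl⟩
    · rintro ⟨w, hw, rfl⟩
      exact ⟨hw, w, w.2, rfl⟩
  rw [hmap]
  exact (Submodule.equivMapOfInjective (T t) hinj (D t)).finrank_eq.symm

/-- The left translation action of the free group on two generators on `ℓ²(F₂; ℂ)` is
not algebraically amenable. -/
theorem freeGroup_translation_action_not_algebraically_amenable :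
    ¬ AlgebraicallyAmenableAction
        (fun γ : FreeGroup (Fin 2) => lpTranslate γ) := by
  intro h
  obtain ⟨W, hW, hfin, hlt⟩ :=
    h 3 ![1, FreeGroup.of 0, FreeGroup.of 1] (1 / 2) (by norm_num)
  have hsum := sum_finrank_inf_map_lpTranslate_lt W hW
  rw [Fin.sum_univ_two] at hsum
  have hone : W.map (lpTranslate (1 : FreeGroup (Fin 2))) = W := by
    have : lpTranslate (1 : FreeGroup (Fin 2)) = LinearMap.id := by
      ext f δ
      simp [lpTranslate]
    rw [this, Submodule.map_id]
  set S := ⨆ i, W.map (lpTranslate (![1, FreeGroup.of 0, FreeGroup.of 1] i)) with hS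
  have hfinS : FiniteDimensional ℂ S := inferInstance
  have hle (i : Fin 3) : W.map (lpTranslate (![1, FreeGroup.of 0, FreeGroup.of 1] i)) ≤ S :=
    le_iSup (fun i => W.map (lpTranslate (![1, FreeGroup.of 0, FreeGroup.of 1] i))) i
  have hWS : W ≤ S := by simpa [hone] using hle 0
  have hexpand (t : Fin 2) (ht : W.map (lpTranslate (FreeGroup.of t)) ≤ S) :
      2 * Module.finrank ℂ W ≤ Module.finrank ℂ S +
        Module.finrank ℂ ↥(W ⊓ W.map (lpTranslate (FreeGroup.of t))) := by
    have h1 := Submodule.finrank_sup_add_finrank_inf_eq W (W.map (lpTranslate (FreeGroup.of t)))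
    have h2 := (Submodule.equivMapOfInjective _
      (lpTranslate_injective (FreeGroup.of t)) W).finrank_eq
    have h3 := Submodule.finrank_mono (sup_le hWS ht)
    omega
  have h0 := hexpand 0 (hle 1)
  have h1 := hexpand 1 (hle 2)
  have hnat : 3 * Module.finrank ℂ W ≤ 2 * Module.finrank ℂ S := by omega
  have hreal : (3 : ℝ) * Module.finrank ℂ W ≤ 2 * Module.finrank ℂ S := by exact_mod_cast hnat
  change (Module.finrank ℂ S : ℝ) < _ at hlt
  linarith
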